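/- arXiv:math/0703084 — 4 statements merged into one kernel-verified Lean document; each statement's English description precedes it below -/
import Mathlib

section
/- Let q ≥ 1, δ > 0, b_k > a_k > 0 for k = 1,…,q, and set L = ∏_{i=1}^q [Γ(a_i) Γ(a_i+δ−σ) Γ(b_i−σ) Γ(b_i+δ)] / [Γ(a_i−σ) Γ(a_i+δ) Γ(b_i) Γ(b_i+δ−σ)] and f(x) = F(σ;(a_q)+δ;(b_q)+δ;−x)/F(σ;(a_q);(b_q);−x). If 0 < σ < min(a_1,…,a_q), then for every x > 0 one has L < f(x) < 1; if σ < 0, then for every x > 0 one has 1 < f(x) < L. -/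
open MeasureTheory Real Filter

/-- Generalized hypergeometric function `F(σ;(a_q);(b_q);−x)` (with `q = n+1` upper/lower
parameter pairs), defined via the multiple Euler integral. -/
noncomputable def hypF {n : ℕ} (σ : ℝ) (a b : Fin (n + 1) → ℝ) (x : ℝ) : ℝ :=
  (∏ k, Gamma (b k) / (Gamma (a k) * Gamma (b k - a k))) *
    ∫ t : Fin (n + 1) → ℝ in Set.univ.pi fun _ => Set.Icc (0 : ℝ) 1,
      (∏ k, t k ^ (a k - 1) * (1 - t k) ^ (b k - a k - 1)) * (1 + (∏ k, t k) * x) ^ (-σ)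

theorem cheb_aux {α : Type*} [MeasurableSpace α] (μ : Measure α) (w T : α → ℝ) (φ : ℝ → ℝ) (δ : ℝ)
    (hδ : 0 < δ) (hφ : StrictMonoOn φ (Set.Ioi 0))
    (hw : ∀ᵐ t ∂μ, 0 < w t) (hT : ∀ᵐ t ∂μ, 0 < T t)
    (hne : ∀ c : ℝ, ¬ ∀ᵐ t ∂μ, T t = c)
    (i1 : Integrable w μ) (i2 : Integrable (fun t => w t * T t ^ δ) μ)
    (i3 : Integrable (fun t => w t * φ (T t)) μ)
    (i4 : Integrable (fun t => w t * T t ^ δ * φ (T t)) μ) :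
    (∫ t, w t * T t ^ δ ∂μ) * (∫ t, w t * φ (T t) ∂μ) <
      (∫ t, w t ∂μ) * (∫ t, w t * T t ^ δ * φ (T t) ∂μ) := by
  have pos : ∀ f : α → ℝ, Integrable f μ → (∀ᵐ t ∂μ, 0 ≤ f t) →
      (∃ c : ℝ, ∀ᵐ t ∂μ, f t = 0 → T t = c) → 0 < ∫ t, f t ∂μ := by
    rintro f hf h0 ⟨c, hc⟩
    refine lt_of_le_of_ne (integral_nonneg_of_ae h0) fun h => hne c ?_
    have := (integral_eq_zero_iff_of_nonneg_ae h0 hf).1 h.symm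
    filter_upwards [this, hc] with t h1 h2 using h2 h1
  have hA : 0 < ∫ t, w t ∂μ := pos _ i1 (hw.mono fun t h => h.le)
    ⟨0, hw.mono fun t h h' => absurd h' h.ne'⟩
  have hB : 0 < ∫ t, w t * T t ^ δ ∂μ := by
    have : ∀ᵐ t ∂μ, 0 < w t * T t ^ δ := by
      filter_upwards [hw, hT] with t h1 h2 using mul_pos h1 (rpow_pos_of_pos h2 _)
    exact pos _ i2 (this.mono fun t h => h.le) ⟨0, this.mono fun t h h' => absurd h' h.ne'⟩
  set A := ∫ t, w t ∂μ
  set B := ∫ t, w t * T t ^ δ ∂μ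
  set m := B / A with hm
  have hmpos : 0 < m := div_pos hB hA
  set τ := m ^ δ⁻¹ with hτ
  have hτpos : 0 < τ := rpow_pos_of_pos hmpos _
  have hτm : τ ^ δ = m := rpow_inv_rpow hmpos.le hδ.ne'
  have key : ∀ᵐ t ∂μ, 0 ≤ w t * ((T t ^ δ - m) * (φ (T t) - φ τ)) ∧
      (w t * ((T t ^ δ - m) * (φ (T t) - φ τ)) = 0 → T t = τ) := by
    filter_upwards [hw, hT] with t h1 h2
    rcases lt_trichotomy (T t) τ with h | h | h
    · have e1 : T t ^ δ < m := hτm ▸ rpow_lt_rpow h2.le h hδ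
      have e2 : φ (T t) < φ τ := hφ h2 hτpos h
      have := mul_pos h1 (mul_pos_of_neg_of_neg (sub_neg.2 e1) (sub_neg.2 e2))
      exact ⟨this.le, fun h' => absurd h' this.ne'⟩
    · simp [h]
    · have e1 : m < T t ^ δ := hτm ▸ rpow_lt_rpow hτpos.le h hδ
      have e2 : φ τ < φ (T t) := hφ hτpos h2 h
      have := mul_pos h1 (mul_pos (sub_pos.2 e1) (sub_pos.2 e2))
      exact ⟨this.le, fun h' => absurd h' this.ne'⟩
  have e : (fun t => w t * ((T t ^ δ - m) * (φ (T t) - φ τ))) = fun t =>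
      (w t * T t ^ δ * φ (T t) - m * (w t * φ (T t))) -
        (φ τ * (w t * T t ^ δ) - φ τ * m * w t) := by
    funext t; ring
  have ig : Integrable (fun t => (w t * T t ^ δ * φ (T t) - m * (w t * φ (T t))) -
        (φ τ * (w t * T t ^ δ) - φ τ * m * w t)) μ :=
    (i4.sub (i3.const_mul m)).sub ((i2.const_mul _).sub (i1.const_mul _))
  have hpos := pos _ (e ▸ ig) (key.mono fun t h => h.1) ⟨τ, key.mono fun t h => h.2⟩
  have k1 : Integrable (fun t => w t * T t ^ δ * φ (T t) - m * (w t * φ (T t))) μ :=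
    i4.sub (i3.const_mul m)
  have k2 : Integrable (fun t => φ τ * (w t * T t ^ δ) - φ τ * m * w t) μ :=
    (i2.const_mul _).sub (i1.const_mul _)
  rw [e, integral_sub k1 k2,
    integral_sub i4 (i3.const_mul m), integral_sub (i2.const_mul _) (i1.const_mul _),
    integral_const_mul, integral_const_mul, integral_const_mul] at hpos
  change 0 < _ - m * _ - (φ τ * B - φ τ * m * A) at hpos
  have hmA : m * A = B := div_mul_cancel₀ _ hA.ne'
  have : 0 < A * ((∫ t, w t * T t ^ δ * φ (T t) ∂μ) - m * (∫ t, w t * φ (T t) ∂μ)) := by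
    apply mul_pos hA
    have : φ τ * B - φ τ * m * A = 0 := by rw [← hmA]; ring
    linarith
  have : A * (m * (∫ t, w t * φ (T t) ∂μ)) = B * (∫ t, w t * φ (T t) ∂μ) := by
    rw [← hmA]; ring
  linarith

theorem cheb_anti {α : Type*} [MeasurableSpace α] (μ : Measure α) (w T : α → ℝ) (φ : ℝ → ℝ) (δ : ℝ)
    (hδ : 0 < δ) (hφ : StrictAntiOn φ (Set.Ioi 0))
    (hw : ∀ᵐ t ∂μ, 0 < w t) (hT : ∀ᵐ t ∂μ, 0 < T t)
    (hne : ∀ c : ℝ, ¬ ∀ᵐ t ∂μ, T t = c)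
    (i1 : Integrable w μ) (i2 : Integrable (fun t => w t * T t ^ δ) μ)
    (i3 : Integrable (fun t => w t * φ (T t)) μ)
    (i4 : Integrable (fun t => w t * T t ^ δ * φ (T t)) μ) :
    (∫ t, w t ∂μ) * (∫ t, w t * T t ^ δ * φ (T t) ∂μ) <
    (∫ t, w t * T t ^ δ ∂μ) * (∫ t, w t * φ (T t) ∂μ) := by
  have := cheb_aux μ w T (fun x => - φ x) δ hδ hφ.neg hw hT hne i1 i2
    (by simpa using i3.neg) (by simpa using i4.neg)
  simp only [mul_neg, integral_neg] at this
  linarith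

theorem beta_ok (α β : ℝ) (hα : 0 < α) (hβ : 0 < β) :
    IntegrableOn (fun x : ℝ => x ^ (α - 1) * (1 - x) ^ (β - 1)) (Set.Ioo 0 1) ∧
    ∫ x in Set.Ioo (0:ℝ) 1, x ^ (α - 1) * (1 - x) ^ (β - 1) =
      Gamma α * Gamma β / Gamma (α + β) := by
  have h := Complex.betaIntegral_convergent (u := α) (v := β) (by simpa) (by simpa)
  rw [intervalIntegrable_iff_integrableOn_Ioc_of_le (by simp), IntegrableOn] at h
  have e : ∀ x ∈ Set.Ioc (0:ℝ) 1, RCLike.re ((x:ℂ) ^ ((α:ℂ) - 1) * (1 - (x:ℂ)) ^ ((β:ℂ) - 1)) =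
      x ^ (α - 1) * (1 - x) ^ (β - 1) := by
    rintro x ⟨hx1, hx2⟩
    norm_cast
    rw [← Complex.ofReal_cpow, ← Complex.ofReal_cpow, RCLike.re_to_complex,
        Complex.re_mul_ofReal, Complex.ofReal_re]
    all_goals linarith
  constructor
  · have h2 : IntegrableOn (fun x : ℝ => x ^ (α - 1) * (1 - x) ^ (β - 1)) (Set.Ioc 0 1) :=
      IntegrableOn.congr_fun (f := fun x : ℝ => RCLike.re ((x:ℂ) ^ ((α:ℂ) - 1) * (1 - (x:ℂ)) ^ ((β:ℂ) - 1))) h.re e measurableSet_Ioc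
    exact h2.mono_set Set.Ioo_subset_Ioc_self
  · have := ProbabilityTheory.beta_eq_betaIntegralReal α β hα hβ
    rw [ProbabilityTheory.beta] at this
    rw [this, Complex.betaIntegral, intervalIntegral.integral_of_le (by norm_num),
      ← integral_Ioc_eq_integral_Ioo, ← RCLike.re_to_complex, ← integral_re h]
    exact (setIntegral_congr_fun measurableSet_Ioc e).symm

/-- the open cube measure -/
noncomputable def cubeM (n : ℕ) : Measure (Fin (n+1) → ℝ) :=
  volume.restrict (Set.univ.pi fun _ => Set.Ioo (0 : ℝ) 1)

/-- the weight -/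
noncomputable def wt {n : ℕ} (a c : Fin (n + 1) → ℝ) (t : Fin (n + 1) → ℝ) : ℝ :=
  ∏ k, t k ^ (a k - 1) * (1 - t k) ^ (c k - 1)

theorem cubeM_pi (n : ℕ) :
    cubeM n = Measure.pi fun _ => (volume : Measure ℝ).restrict (Set.Ioo 0 1) := by
  rw [cubeM, volume_pi, Measure.restrict_pi_pi]

theorem cube_meas (n : ℕ) :
    MeasurableSet (Set.univ.pi fun _ : Fin (n+1) => Set.Ioo (0 : ℝ) 1) :=
  MeasurableSet.univ_pi fun _ => measurableSet_Ioo

theorem cube_ae (n : ℕ) : ∀ᵐ t ∂cubeM n, ∀ k, 0 < t k ∧ t k < 1 := by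
  filter_upwards [ae_restrict_mem (cube_meas n)] with t ht k
  exact ht k (Set.mem_univ k)

theorem wt_int {n : ℕ} (a c : Fin (n + 1) → ℝ) (ha : ∀ k, 0 < a k) (hc : ∀ k, 0 < c k) :
    Integrable (wt a c) (cubeM n) := by
  rw [cubeM_pi]
  exact Integrable.fintype_prod (f := fun k (x : ℝ) => x ^ (a k - 1) * (1 - x) ^ (c k - 1))
    fun k => (beta_ok _ _ (ha k) (hc k)).1

theorem wt_val {n : ℕ} (a c : Fin (n + 1) → ℝ) (ha : ∀ k, 0 < a k) (hc : ∀ k, 0 < c k) :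
    ∫ t, wt a c t ∂(cubeM n) = ∏ k, Gamma (a k) * Gamma (c k) / Gamma (a k + c k) := by
  rw [cubeM_pi]
  unfold wt
  rw [integral_fintype_prod_eq_prod (f := fun k (x : ℝ) => x ^ (a k - 1) * (1 - x) ^ (c k - 1))]
  exact Finset.prod_congr rfl fun k _ => (beta_ok _ _ (ha k) (hc k)).2

theorem wt_shift {n : ℕ} (a a' c : Fin (n + 1) → ℝ) (s : ℝ) (h : ∀ k, a' k = a k + s)
    (t : Fin (n + 1) → ℝ) (ht : ∀ k, 0 < t k ∧ t k < 1) :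
    wt a' c t = wt a c t * (∏ k, t k) ^ s := by
  unfold wt
  rw [← finsetProd_rpow _ _ (fun k _ => (ht k).1.le), ← Finset.prod_mul_distrib]
  refine Finset.prod_congr rfl fun k _ => ?_
  rw [h, show a k + s - 1 = (a k - 1) + s by ring, rpow_add (ht k).1]
  ring

theorem wt_pos {n : ℕ} (a c : Fin (n + 1) → ℝ)
    (t : Fin (n + 1) → ℝ) (ht : ∀ k, 0 < t k ∧ t k < 1) : 0 < wt a c t :=
  Finset.prod_pos fun k _ => mul_pos (rpow_pos_of_pos (ht k).1 _)
    (rpow_pos_of_pos (sub_pos.2 (ht k).2) _)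

theorem prod_nonconst (n : ℕ) (c : ℝ) : ¬ ∀ᵐ t ∂cubeM n, ∏ k, t k = c := by
  intro h
  rw [cubeM, ae_restrict_iff' (cube_meas n)] at h
  have hopen : IsOpen ((Set.univ.pi fun _ : Fin (n+1) => Set.Ioo (0 : ℝ) 1) ∩
      {t | ∏ k, t k ≠ c}) := by
    refine (isOpen_set_pi Set.finite_univ fun _ _ => isOpen_Ioo).inter ?_
    exact isOpen_ne.preimage (by fun_prop : Continuous fun t : Fin (n+1) → ℝ => ∏ k, t k)
  have h0 : volume ((Set.univ.pi fun _ : Fin (n+1) => Set.Ioo (0 : ℝ) 1) ∩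
      {t | ∏ k, t k ≠ c}) = 0 := by
    refine measure_mono_null ?_ h
    rintro t ⟨h1, h2⟩ h3
    exact h2 (h3 h1)
  have he := hopen.measure_eq_zero_iff volume |>.1 h0
  have h1 : ∀ r : ℝ, 0 < r → r < 1 → r ^ (n+1) = c := by
    intro r hr hr1
    by_contra hne
    have : (fun _ => r) ∈ ((Set.univ.pi fun _ : Fin (n+1) => Set.Ioo (0 : ℝ) 1) ∩
      {t | ∏ k, t k ≠ c}) := ⟨fun _ _ => ⟨hr, hr1⟩, by simpa using hne⟩
    rw [he] at this
    exact this
  have h2 := (h1 (1/3) (by norm_num) (by norm_num)).trans (h1 (1/2) (by norm_num) (by norm_num)).symm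
  have h3 : (1/3:ℝ) ^ (n+1) < (1/2) ^ (n+1) := pow_lt_pow_left₀ (by norm_num) (by norm_num) (by simp)
  linarith

theorem hypF_eq {n : ℕ} (σ : ℝ) (a b c : Fin (n + 1) → ℝ) (x : ℝ)
    (hc : ∀ k, c k = b k - a k) (ha : ∀ k, 0 < a k) (hcp : ∀ k, 0 < c k) :
    hypF σ a b x = (∫ t, wt a c t ∂cubeM n)⁻¹ *
      ∫ t, wt a c t * (1 + (∏ k, t k) * x) ^ (-σ) ∂cubeM n := by
  rw [wt_val a c ha hcp, hypF, ← Finset.prod_inv_distrib]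
  congr 1
  · refine Finset.prod_congr rfl fun k _ => ?_
    rw [inv_div, hc]; congr 2; ring
  · have : cubeM n = volume.restrict (Set.univ.pi fun _ => Set.Icc (0:ℝ) 1) :=
      Measure.restrict_congr_set (by
        rw [Set.pi_univ_Icc, volume_pi]
        exact Measure.univ_pi_Ioo_ae_eq_Icc)
    rw [this]
    simp only [wt, hc]

theorem g_int {n : ℕ} (σ : ℝ) (a c : Fin (n + 1) → ℝ) (x : ℝ) (hx : 0 < x)
    (ha : ∀ k, 0 < a k) (hcp : ∀ k, 0 < c k) :
    Integrable (fun t => wt a c t * (1 + (∏ k, t k) * x) ^ (-σ)) (cubeM n) := by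
  refine (wt_int a c ha hcp).mul_bdd (c := max 1 ((1 + x) ^ (-σ))) ?_ ?_
  · exact (by fun_prop : Measurable fun t : Fin (n+1) → ℝ =>
      (1 + (∏ k, t k) * x) ^ (-σ)).aestronglyMeasurable
  · filter_upwards [cube_ae n] with t ht
    have h1 : 0 ≤ ∏ k, t k := Finset.prod_nonneg fun k _ => (ht k).1.le
    have h2 : ∏ k, t k ≤ 1 := Finset.prod_le_one (fun k _ => (ht k).1.le) fun k _ => (ht k).2.le
    have h3 : 0 ≤ (∏ k, t k) * x := by positivity
    have h4 : (∏ k, t k) * x ≤ x := by nlinarith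
    rw [norm_of_nonneg (rpow_nonneg (by linarith) _)]
    rcases le_total σ 0 with h | h
    · exact le_max_of_le_right (rpow_le_rpow (by linarith) (by linarith) (by linarith))
    · exact le_max_of_le_left (rpow_le_one_of_one_le_of_nonpos (by linarith) (by linarith))

theorem core {n : ℕ} (σ δ : ℝ) (a c : Fin (n + 1) → ℝ) (x : ℝ) (hx : 0 < x) (hδ : 0 < δ)
    (ha : ∀ k, 0 < a k) (hc : ∀ k, 0 < c k) (hs : ∀ k, 0 < a k - σ)
    (I J : ℝ → ℝ) (hI : ∀ s, I s = ∫ t, wt (fun k => a k + s) c t ∂cubeM n)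
    (hJ : ∀ s, J s = ∫ t, wt (fun k => a k + s) c t * (1 + (∏ k, t k) * x) ^ (-σ) ∂cubeM n) :
    (0 < σ → I 0 * J δ < I δ * J 0 ∧ I (δ - σ) * J 0 < I (-σ) * J δ) ∧
    (σ < 0 → I δ * J 0 < I 0 * J δ ∧ I (-σ) * J δ < I (δ - σ) * J 0) := by
  have T0 : ∀ᵐ t ∂cubeM n, 0 < ∏ k, t k := by
    filter_upwards [cube_ae n] with t ht using Finset.prod_pos fun k _ => (ht k).1
  have W0 : ∀ s, ∀ᵐ t ∂cubeM n, 0 < wt (fun k => a k + s) c t := by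
    intro s
    filter_upwards [cube_ae n] with t ht using wt_pos _ _ t ht
  have sh : ∀ s s', (fun t => wt (fun k => a k + s') c t) =ᵐ[cubeM n] fun t =>
      wt (fun k => a k + s) c t * (∏ k, t k) ^ (s' - s) := by
    intro s s'
    filter_upwards [cube_ae n] with t ht
    exact wt_shift _ _ _ _ (fun k => by ring) t ht
  have iI : ∀ s, (∀ k, 0 < a k + s) → Integrable (fun t => wt (fun k => a k + s) c t) (cubeM n) :=
    fun s h => wt_int _ _ h hc
  have iJ : ∀ s, (∀ k, 0 < a k + s) → Integrable (fun t => wt (fun k => a k + s) c t *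
      (1 + (∏ k, t k) * x) ^ (-σ)) (cubeM n) :=
    fun s h => g_int _ _ _ _ hx h hc
  have p0 : ∀ k, 0 < a k + 0 := fun k => by linarith [ha k]
  have pδ : ∀ k, 0 < a k + δ := fun k => by linarith [ha k]
  have pσ : ∀ k, 0 < a k + -σ := fun k => by linarith [hs k]
  have pδσ : ∀ k, 0 < a k + (δ - σ) := fun k => by linarith [hs k]
  have E1 : (fun t => wt (fun k => a k + δ) c t) =ᵐ[cubeM n] fun t =>
      wt (fun k => a k + 0) c t * (∏ k, t k) ^ δ := by simpa using sh 0 δ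
  have E2 : (fun t => wt (fun k => a k + δ) c t * (1 + (∏ k, t k) * x) ^ (-σ)) =ᵐ[cubeM n] fun t =>
      wt (fun k => a k + 0) c t * (∏ k, t k) ^ δ * (1 + (∏ k, t k) * x) ^ (-σ) := by
    filter_upwards [E1] with t h
    rw [h]
  have E3 : (fun t => wt (fun k => a k + (δ - σ)) c t) =ᵐ[cubeM n] fun t =>
      wt (fun k => a k + -σ) c t * (∏ k, t k) ^ δ := by
    have := sh (-σ) (δ - σ)
    rwa [show δ - σ - -σ = δ by ring] at this
  have G : ∀ T : ℝ, 0 < T → T ^ σ * (1 + T * x) ^ (-σ) = (T⁻¹ + x) ^ (-σ) := by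
    intro T hT
    have : T⁻¹ + x = T⁻¹ * (1 + T * x) := by field_simp
    rw [this, mul_rpow (by positivity) (by positivity), inv_rpow hT.le, rpow_neg hT.le, inv_inv]
  have E4 : (fun t => wt (fun k => a k + 0) c t * (1 + (∏ k, t k) * x) ^ (-σ)) =ᵐ[cubeM n] fun t =>
      wt (fun k => a k + -σ) c t * ((∏ k, t k)⁻¹ + x) ^ (-σ) := by
    filter_upwards [sh (-σ) 0, T0] with t h h0
    rw [h, ← G _ h0, show 0 - -σ = σ by ring]; ring
  have E5 : (fun t => wt (fun k => a k + δ) c t * (1 + (∏ k, t k) * x) ^ (-σ)) =ᵐ[cubeM n] fun t =>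
      wt (fun k => a k + -σ) c t * (∏ k, t k) ^ δ * ((∏ k, t k)⁻¹ + x) ^ (-σ) := by
    filter_upwards [sh (-σ) δ, T0] with t h h0
    rw [h, ← G _ h0, show δ - -σ = δ + σ by ring, rpow_add h0]; ring
  have i1 := (iI δ pδ).congr E1
  have i2 := (iJ δ pδ).congr E2
  have i3 := (iI _ pδσ).congr E3
  have i4 := (iJ 0 p0).congr E4
  have i5 := (iJ δ pδ).congr E5
  constructor
  · intro hσ
    constructor
    · rw [hI, hI, hJ, hJ, integral_congr_ae E1, integral_congr_ae E2]
      refine cheb_anti (cubeM n) _ (fun t => ∏ k, t k) (fun T => (1 + T * x) ^ (-σ)) δ hδ ?_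
        (W0 0) T0 (prod_nonconst n) (iI 0 p0) i1 (iJ 0 p0) i2
      intro u hu v hv huv
      have hu : 0 < u := hu
      exact rpow_lt_rpow_of_neg (by positivity) (by nlinarith) (by linarith)
    · rw [hI, hI, hJ, hJ, integral_congr_ae E3, integral_congr_ae E4, integral_congr_ae E5]
      refine cheb_aux (cubeM n) _ (fun t => ∏ k, t k) (fun T => (T⁻¹ + x) ^ (-σ)) δ hδ ?_
        (W0 _) T0 (prod_nonconst n) (iI _ pσ) i3 i4 i5
      intro u hu v hv huv
      have hu : 0 < u := hu
      have hv : 0 < v := hv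
      have := inv_strictAnti₀ hu huv
      exact rpow_lt_rpow_of_neg (by positivity) (by linarith) (by linarith)
  · intro hσ
    constructor
    · rw [hI, hI, hJ, hJ, integral_congr_ae E1, integral_congr_ae E2]
      refine cheb_aux (cubeM n) _ (fun t => ∏ k, t k) (fun T => (1 + T * x) ^ (-σ)) δ hδ ?_
        (W0 0) T0 (prod_nonconst n) (iI 0 p0) i1 (iJ 0 p0) i2
      intro u hu v hv huv
      have hu : 0 < u := hu
      exact rpow_lt_rpow (by positivity) (by nlinarith) (by linarith)
    · rw [hI, hI, hJ, hJ, integral_congr_ae E3, integral_congr_ae E4, integral_congr_ae E5]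
      refine cheb_anti (cubeM n) _ (fun t => ∏ k, t k) (fun T => (T⁻¹ + x) ^ (-σ)) δ hδ ?_
        (W0 _) T0 (prod_nonconst n) (iI _ pσ) i3 i4 i5
      intro u hu v hv huv
      have hu : 0 < u := hu
      have hv : 0 < v := hv
      have := inv_strictAnti₀ hu huv
      exact rpow_lt_rpow (by positivity) (by linarith) (by linarith)

theorem final_aux {n : ℕ} (σ δ : ℝ) (a b : Fin (n + 1) → ℝ) (x : ℝ) (hx : 0 < x) (hδ : 0 < δ)
    (hab : ∀ k, 0 < a k ∧ a k < b k) (hs : ∀ k, 0 < a k - σ) :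
    ∃ I0 Id Is Ids J0 Jd : ℝ, 0 < I0 ∧ 0 < Id ∧ 0 < Is ∧ 0 < Ids ∧ 0 < J0 ∧
      hypF σ (fun k => a k + δ) (fun k => b k + δ) x / hypF σ a b x = (I0 * Jd) / (Id * J0) ∧
      (∏ i, Gamma (a i) * Gamma (a i + δ - σ) * Gamma (b i - σ) * Gamma (b i + δ) /
        (Gamma (a i - σ) * Gamma (a i + δ) * Gamma (b i) * Gamma (b i + δ - σ))) =
          (I0 * Ids) / (Is * Id) ∧
      (0 < σ → I0 * Jd < Id * J0 ∧ Ids * J0 < Is * Jd) ∧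
      (σ < 0 → Id * J0 < I0 * Jd ∧ Is * Jd < Ids * J0) := by
  set c : Fin (n+1) → ℝ := fun k => b k - a k with hcdef
  have hc : ∀ k, 0 < c k := fun k => sub_pos.2 (hab k).2
  have ha : ∀ k, 0 < a k := fun k => (hab k).1
  have C := core σ δ a c x hx hδ ha hc hs _ _ (fun s => rfl) (fun s => rfl)
  have val : ∀ s, (∀ k, 0 < a k + s) → ∫ t, wt (fun k => a k + s) c t ∂cubeM n =
      ∏ k, Gamma (a k + s) * Gamma (c k) / Gamma (b k + s) := by
    intro s h
    rw [wt_val _ _ h hc]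
    refine Finset.prod_congr rfl fun k _ => ?_
    rw [show a k + s + c k = b k + s by simp only [hcdef]; ring]
  have vpos : ∀ s, (∀ k, 0 < a k + s) → 0 < ∏ k, Gamma (a k + s) * Gamma (c k) / Gamma (b k + s) :=
    fun s h => Finset.prod_pos fun k _ => div_pos
      (mul_pos (Gamma_pos_of_pos (h k)) (Gamma_pos_of_pos (hc k)))
      (Gamma_pos_of_pos (by linarith [h k, (hab k).2]))
  have p0 : ∀ k, 0 < a k + 0 := fun k => by linarith [ha k]
  have pδ : ∀ k, 0 < a k + δ := fun k => by linarith [ha k]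
  have pσ : ∀ k, 0 < a k + -σ := fun k => by linarith [hs k]
  have pδσ : ∀ k, 0 < a k + (δ - σ) := fun k => by linarith [hs k]
  have hJ0 : 0 < ∫ t, wt (fun k => a k + 0) c t * (1 + (∏ k, t k) * x) ^ (-σ) ∂cubeM n := by
    have hp : ∀ᵐ t ∂cubeM n, 0 < wt (fun k => a k + 0) c t * (1 + (∏ k, t k) * x) ^ (-σ) := by
      filter_upwards [cube_ae n] with t ht
      have : 0 < ∏ k, t k := Finset.prod_pos fun k _ => (ht k).1
      exact mul_pos (wt_pos _ _ t ht) (rpow_pos_of_pos (by positivity) _)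
    refine lt_of_le_of_ne (integral_nonneg_of_ae (hp.mono fun t h => h.le)) fun h => ?_
    have := (integral_eq_zero_iff_of_nonneg_ae (hp.mono fun t h => h.le)
      (g_int _ _ _ _ hx p0 hc)).1 h.symm
    apply prod_nonconst n 0
    filter_upwards [this, hp] with t h1 h2
    exact absurd h1 h2.ne'
  refine ⟨_, _, _, _, _, _, ?_, ?_, ?_, ?_, hJ0, ?_, ?_, C⟩
  · rw [val _ p0]; exact vpos _ p0
  · rw [val _ pδ]; exact vpos _ pδ
  · rw [val _ pσ]; exact vpos _ pσ
  · rw [val _ pδσ]; exact vpos _ pδσ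
  · have h0 := (vpos _ p0).ne'
    have h1 := (vpos _ pδ).ne'
    rw [← val _ p0] at h0
    rw [← val _ pδ] at h1
    rw [hypF_eq σ (fun k => a k + δ) (fun k => b k + δ) c x (fun k => by simp [hcdef]) pδ hc,
      hypF_eq σ a b c x (fun k => rfl) ha hc]
    simp only [add_zero] at h0 hJ0 ⊢
    have h2 := hJ0.ne'
    change ∫ t, wt a c t ∂cubeM n ≠ 0 at h0
    change ∫ t, wt a c t * (1 + (∏ k, t k) * x) ^ (-σ) ∂cubeM n ≠ 0 at h2
    change _ = (∫ t, wt a c t ∂cubeM n) * _ /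
      (_ * ∫ t, wt a c t * (1 + (∏ k, t k) * x) ^ (-σ) ∂cubeM n)
    generalize (∫ t, wt a c t ∂cubeM n) = A at *
    generalize (∫ t, wt a c t * (1 + (∏ k, t k) * x) ^ (-σ) ∂cubeM n) = B at *
    generalize (∫ t, wt (fun k => a k + δ) c t ∂cubeM n) = A' at *
    generalize (∫ t, wt (fun k => a k + δ) c t * (1 + (∏ k, t k) * x) ^ (-σ) ∂cubeM n) = B' at *
    field_simp
  · rw [val _ p0, val _ pδ, val _ pσ, val _ pδσ, ← Finset.prod_mul_distrib,
      ← Finset.prod_mul_distrib, ← Finset.prod_div_distrib]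
    refine Finset.prod_congr rfl fun k _ => ?_
    have := (hab k).2
    have g1 := (Gamma_pos_of_pos (hc k)).ne'
    have g2 := (Gamma_pos_of_pos (hs k)).ne'
    have g3 := (Gamma_pos_of_pos (pδ k)).ne'
    have g4 := (Gamma_pos_of_pos (show 0 < b k by linarith [ha k])).ne'
    have g5 := (Gamma_pos_of_pos (show 0 < b k + δ - σ by linarith [hs k])).ne'
    have g6 := (Gamma_pos_of_pos (show 0 < b k - σ by linarith [hs k])).ne'
    have g7 := (Gamma_pos_of_pos (show 0 < b k + δ by linarith [ha k])).ne'
    simp only [add_zero, ← sub_eq_add_neg, ← add_sub_assoc]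
    field_simp

/-- Two-sided bounds for the ratio `f(x) = F(σ;(a_q)+δ;(b_q)+δ;−x)/F(σ;(a_q);(b_q);−x)`
in terms of its value `L` at `x = ∞`. -/
theorem ratio_bounds {n : ℕ} (σ δ : ℝ) (a b : Fin (n + 1) → ℝ) (hδ : 0 < δ)
    (hab : ∀ k, 0 < a k ∧ a k < b k) :
    ((0 < σ ∧ ∀ k, σ < a k) → ∀ x > (0 : ℝ),
      (∏ i, Gamma (a i) * Gamma (a i + δ - σ) * Gamma (b i - σ) * Gamma (b i + δ) /
        (Gamma (a i - σ) * Gamma (a i + δ) * Gamma (b i) * Gamma (b i + δ - σ))) <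
          hypF σ (fun k => a k + δ) (fun k => b k + δ) x / hypF σ a b x ∧
      hypF σ (fun k => a k + δ) (fun k => b k + δ) x / hypF σ a b x < 1) ∧
    (σ < 0 → ∀ x > (0 : ℝ),
      1 < hypF σ (fun k => a k + δ) (fun k => b k + δ) x / hypF σ a b x ∧
      hypF σ (fun k => a k + δ) (fun k => b k + δ) x / hypF σ a b x <
        (∏ i, Gamma (a i) * Gamma (a i + δ - σ) * Gamma (b i - σ) * Gamma (b i + δ) /
          (Gamma (a i - σ) * Gamma (a i + δ) * Gamma (b i) * Gamma (b i + δ - σ)))) := by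
  constructor
  · rintro ⟨hσ, hs⟩ x hx
    obtain ⟨I0, Id, Is, Ids, J0, Jd, h0, hd, hs', hds, hJ, e1, e2, C, -⟩ :=
      final_aux σ δ a b x hx hδ hab (fun k => sub_pos.2 (hs k))
    obtain ⟨c1, c2⟩ := C hσ
    rw [e1, e2]
    constructor
    · rw [div_lt_div_iff₀ (by positivity) (by positivity)]
      have := mul_lt_mul_of_pos_left c2 (mul_pos h0 hd)
      linarith
    · rw [div_lt_one (by positivity)]
      exact c1
  · intro hσ x hx
    obtain ⟨I0, Id, Is, Ids, J0, Jd, h0, hd, hs', hds, hJ, e1, e2, -, C⟩ :=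
      final_aux σ δ a b x hx hδ hab (fun k => by linarith [(hab k).1])
    obtain ⟨c1, c2⟩ := C hσ
    rw [e1, e2]
    constructor
    · rw [one_lt_div (by positivity)]
      exact c1
    · rw [div_lt_div_iff₀ (by positivity) (by positivity)]
      have := mul_lt_mul_of_pos_left c2 (mul_pos h0 hd)
      linarith
end

section
/- Let q ≥ 1, b_k > a_k > 0 for k = 1,…,q, σ ≥ 1 and x > −1. Then (F(1;(a_q);(b_q);−x))^σ ≤ F(σ;(a_q);(b_q);−x). -/
open MeasureTheory Real Filter

lemma beta_aux (u v : ℝ) (hu : 0 < u) (hv : 0 < v) :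
    IntegrableOn (fun t : ℝ => t ^ (u - 1) * (1 - t) ^ (v - 1)) (Set.Icc 0 1) ∧
    ∫ t in Set.Icc (0:ℝ) 1, t ^ (u - 1) * (1 - t) ^ (v - 1)
      = Gamma u * Gamma v / Gamma (u + v) := by
  have hc := Complex.betaIntegral_convergent (u := u) (v := v) (by simpa) (by simpa)
  rw [intervalIntegrable_iff_integrableOn_Icc_of_le (by simp)] at hc
  have heq : ∀ t ∈ Set.Icc (0:ℝ) 1, (t : ℂ) ^ ((u:ℂ) - 1) * (1 - (t : ℂ)) ^ ((v:ℂ) - 1)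
      = ((t ^ (u - 1) * (1 - t) ^ (v - 1) : ℝ) : ℂ) := by
    intro t ht
    have h1 : 0 ≤ 1 - t := by linarith [ht.2]
    rw [Complex.ofReal_mul, Complex.ofReal_cpow ht.1, Complex.ofReal_cpow h1]
    push_cast
    rfl
  have hc2 := (integrableOn_congr_fun heq measurableSet_Icc).1 hc
  refine ⟨by simpa [IntegrableOn] using hc2.re, ?_⟩
  have hb := ProbabilityTheory.beta_eq_betaIntegralReal u v hu hv
  rw [ProbabilityTheory.beta] at hb
  rw [hb, Complex.betaIntegral, intervalIntegral.integral_of_le zero_le_one,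
    ← integral_Icc_eq_integral_Ioc, setIntegral_congr_fun measurableSet_Icc heq, integral_complex_ofReal,
    Complex.ofReal_re]

lemma box_aux {n : ℕ} (a b : Fin (n + 1) → ℝ) (hab : ∀ k, 0 < a k ∧ a k < b k) :
    IntegrableOn (fun t : Fin (n + 1) → ℝ => ∏ k, t k ^ (a k - 1) * (1 - t k) ^ (b k - a k - 1))
      (Set.univ.pi fun _ => Set.Icc (0 : ℝ) 1) ∧
    (∏ k, Gamma (b k) / (Gamma (a k) * Gamma (b k - a k))) *
    ∫ t : Fin (n + 1) → ℝ in Set.univ.pi fun _ => Set.Icc (0 : ℝ) 1,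
      (∏ k, t k ^ (a k - 1) * (1 - t k) ^ (b k - a k - 1)) = 1 := by
  have hB := fun k => beta_aux (a k) (b k - a k) (hab k).1 (by linarith [(hab k).2])
  constructor
  · rw [IntegrableOn, volume_pi, Measure.restrict_pi_pi]
    exact Integrable.fintype_prod
      (f := fun k (t:ℝ) => t ^ (a k - 1) * (1 - t) ^ (b k - a k - 1)) (fun k => (hB k).1)
  · rw [volume_pi, Measure.restrict_pi_pi, integral_fintype_prod_eq_prod
      (f := fun k (t:ℝ) => t ^ (a k - 1) * (1 - t) ^ (b k - a k - 1)), ← Finset.prod_mul_distrib]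
    refine Finset.prod_eq_one fun k _ => ?_
    rw [(hB k).2]
    have h1 := Gamma_pos_of_pos (hab k).1
    have h2 := Gamma_pos_of_pos (sub_pos.2 (hab k).2)
    have h3 := Gamma_pos_of_pos ((hab k).1.trans (hab k).2)
    rw [add_sub_cancel]
    field_simp

lemma tangent_aux (σ m y : ℝ) (hσ : 1 ≤ σ) (hm : 0 < m) (hy : 0 ≤ y) :
    m ^ σ + σ * m ^ σ / m * (y - m) ≤ y ^ σ := by
  have h := one_add_mul_self_le_rpow_one_add (s := y / m - 1)
    (by have := div_nonneg hy hm.le; linarith) hσ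
  rw [add_sub_cancel, div_rpow hy hm.le, le_div_iff₀ (rpow_pos_of_pos hm σ)] at h
  refine le_trans (le_of_eq ?_) h
  field_simp

/-- Jensen-type inequality: `(F(1;(a_q);(b_q);−x))^σ ≤ F(σ;(a_q);(b_q);−x)` for `σ ≥ 1`. -/
theorem hypF_pow_le {n : ℕ} (σ : ℝ) (a b : Fin (n + 1) → ℝ)
    (hab : ∀ k, 0 < a k ∧ a k < b k) (hσ : 1 ≤ σ) (x : ℝ) (hx : -1 < x) :
    hypF 1 a b x ^ σ ≤ hypF σ a b x := by
  obtain ⟨hw, hC⟩ := box_aux a b hab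
  have hC0 : 0 ≤ ∏ k, Gamma (b k) / (Gamma (a k) * Gamma (b k - a k)) :=
    Finset.prod_nonneg fun k _ => by
      have h1 := Gamma_pos_of_pos (hab k).1
      have h2 := Gamma_pos_of_pos (sub_pos.2 (hab k).2)
      have h3 := Gamma_pos_of_pos ((hab k).1.trans (hab k).2)
      positivity
  have hS : IsCompact (Set.univ.pi fun _ : Fin (n+1) => Set.Icc (0 : ℝ) 1) :=
    isCompact_univ_pi fun _ => isCompact_Icc
  have hw0 : ∀ t ∈ (Set.univ.pi fun _ : Fin (n+1) => Set.Icc (0 : ℝ) 1),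
      0 ≤ ∏ k, t k ^ (a k - 1) * (1 - t k) ^ (b k - a k - 1) := fun t ht =>
    Finset.prod_nonneg fun k _ => mul_nonneg (rpow_nonneg (ht k trivial).1 _)
      (rpow_nonneg (sub_nonneg.2 (ht k trivial).2) _)
  have hpos : ∀ t ∈ (Set.univ.pi fun _ : Fin (n+1) => Set.Icc (0 : ℝ) 1),
      0 < 1 + (∏ k, t k) * x := fun t ht => by
    have h0 : 0 ≤ ∏ k, t k := Finset.prod_nonneg fun k _ => (ht k trivial).1
    have h1 : ∏ k, t k ≤ 1 :=
      Finset.prod_le_one (fun k _ => (ht k trivial).1) (fun k _ => (ht k trivial).2)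
    rcases le_total 0 x with h | h <;> nlinarith
  have hint : ∀ s : ℝ, IntegrableOn (fun t : Fin (n+1) → ℝ =>
      (∏ k, t k ^ (a k - 1) * (1 - t k) ^ (b k - a k - 1)) * (1 + (∏ k, t k) * x) ^ (-s))
      (Set.univ.pi fun _ => Set.Icc (0 : ℝ) 1) := fun s => by
    refine hw.mul_continuousOn ?_ hS
    exact ContinuousOn.rpow_const (by fun_prop) fun t ht => Or.inl (hpos t ht).ne'
  have hnn : ∀ s : ℝ, 0 ≤ hypF s a b x := fun s =>
    mul_nonneg hC0 (setIntegral_nonneg hS.measurableSet fun t ht =>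
      mul_nonneg (hw0 t ht) (rpow_nonneg (hpos t ht).le _))
  rcases (hnn 1).eq_or_lt with h0 | hm
  · rw [← h0, zero_rpow (by linarith)]
    exact hnn σ
  have hmdef : hypF 1 a b x = _ := rfl
  conv_rhs at hmdef => rw [hypF]
  generalize hypF 1 a b x = m at hm hmdef ⊢
  rw [hypF]
  have key := setIntegral_mono_on (((hw.const_mul (m ^ σ - σ * m ^ σ / m * m))).add
    ((hint 1).const_mul (σ * m ^ σ / m))) (hint σ) hS.measurableSet (fun t ht => by
      have h := mul_le_mul_of_nonneg_left (tangent_aux σ m ((1 + (∏ k, t k) * x) ^ (-1:ℝ)) hσ hm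
        (rpow_nonneg (hpos t ht).le _)) (hw0 t ht)
      rw [← rpow_mul (hpos t ht).le, neg_one_mul] at h
      refine le_trans (le_of_eq ?_) h
      simp only [Pi.add_apply]
      ring)
  have key2 := mul_le_mul_of_nonneg_left key hC0
  refine le_trans (le_of_eq ?_) key2
  simp only [Pi.add_apply]
  rw [integral_add (hw.const_mul _) ((hint 1).const_mul _), integral_const_mul, integral_const_mul]
  rw [mul_add, mul_left_comm, hC, mul_left_comm, ← hmdef]
  ring
end

section
/- Let b > a + 1 > 1, 0 < σ ≤ 1 and −1 < x < 0. Then ₂F₁(σ, a; b; −x) < (1 + ax/(b−1))^{−σ}. -/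
open MeasureTheory Real

/-- Gauss hypergeometric function `₂F₁(σ, a; b; −x)` via the Euler integral. -/
noncomputable def eulerF21 (σ a b x : ℝ) : ℝ :=
  Gamma b / (Gamma a * Gamma (b - a)) *
    ∫ t in Set.Ioo (0 : ℝ) 1, t ^ (a - 1) * (1 - t) ^ (b - a - 1) * (1 + x * t) ^ (-σ)

lemma core_lt (σ m x t : ℝ) (hσ0 : 0 < σ) (hσ1 : σ ≤ 1) (hx1 : -1 < x) (hx0 : x < 0)
    (hm0 : 0 < m) (hm1 : m < 1) (ht0 : 0 < t) (ht1 : t < 1) :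
    0 ≤ (1 + m * x) ^ (-σ) * ((1 - t) + σ * (-x) * (1 - m) / (1 + m * x) * (t - m))
        - (1 - t) * (1 + x * t) ^ (-σ) ∧
    (t ≠ m → 0 < (1 + m * x) ^ (-σ) * ((1 - t) + σ * (-x) * (1 - m) / (1 + m * x) * (t - m))
        - (1 - t) * (1 + x * t) ^ (-σ)) := by
  have hU : 0 < 1 + x * t := by nlinarith
  have hV : 0 < 1 + m * x := by nlinarith
  have hP : 0 < (1 + m * x) ^ (-σ) := rpow_pos_of_pos hV _
  have h1 : (1 + x * t) ^ (-σ) = (1 + m * x) ^ (-σ) * (1 + ((1 + m * x) / (1 + x * t) - 1)) ^ σ := by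
    rw [show 1 + ((1 + m * x) / (1 + x * t) - 1) = (1 + m * x) / (1 + x * t) by ring,
      div_rpow hV.le hU.le, rpow_neg hV.le, rpow_neg hU.le]
    have := (rpow_pos_of_pos hV σ).ne'
    rw [div_eq_mul_inv, inv_mul_cancel_left₀ this]
  have h2 := rpow_one_add_le_one_add_mul_self (s := (1 + m * x) / (1 + x * t) - 1) (p := σ)
    (by have := div_pos hV hU; linarith) hσ0.le hσ1
  have h3 : (1 + x * t) ^ (-σ) ≤
      (1 + m * x) ^ (-σ) * (1 + σ * ((1 + m * x) / (1 + x * t) - 1)) := by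
    rw [h1]; exact mul_le_mul_of_nonneg_left h2 hP.le
  have h4 := mul_le_mul_of_nonneg_left h3 (sub_pos.2 ht1).le
  have h5 : (1 + m * x) ^ (-σ) * ((1 - t) + σ * (-x) * (1 - m) / (1 + m * x) * (t - m))
      - (1 - t) * ((1 + m * x) ^ (-σ) * (1 + σ * ((1 + m * x) / (1 + x * t) - 1)))
      = (1 + m * x) ^ (-σ) * (σ * (-x) * (1 + x) / ((1 + m * x) * (1 + x * t))) * (t - m) ^ 2 := by
    generalize (1 + m * x) ^ (-σ) = P
    have hU' : 1 + x * t ≠ 0 := hU.ne'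
    have hV' : 1 + x * m ≠ 0 := by rw [mul_comm x m]; exact hV.ne'
    rw [mul_comm m x]
    obtain ⟨U, hUd⟩ : ∃ U, U = 1 + x * t := ⟨_, rfl⟩
    obtain ⟨V, hVd⟩ : ∃ V, V = 1 + x * m := ⟨_, rfl⟩
    rw [← hUd] at hU' ⊢
    rw [← hVd] at hV' ⊢
    field_simp
    rw [hUd, hVd]
    ring
  have h6 : 0 < (1 + m * x) ^ (-σ) * (σ * (-x) * (1 + x) / ((1 + m * x) * (1 + x * t))) := by
    have : 0 < -x := by linarith
    have : 0 < 1 + x := by linarith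
    positivity
  constructor
  · have := mul_nonneg h6.le (sq_nonneg (t - m))
    linarith
  · intro h
    have : 0 < (t - m) ^ 2 := by
      have := sub_ne_zero.2 h
      positivity
    have := mul_pos h6 this
    linarith

lemma beta_int (u v : ℝ) (hu : 0 < u) (hv : 0 < v) :
    IntegrableOn (fun t : ℝ => t ^ (u - 1) * (1 - t) ^ (v - 1)) (Set.Ioo 0 1) ∧
    ∫ t in Set.Ioo (0 : ℝ) 1, t ^ (u - 1) * (1 - t) ^ (v - 1)
      = Gamma u * Gamma v / Gamma (u + v) := by
  have hc := Complex.betaIntegral_convergent (u := u) (v := v) (by simpa) (by simpa)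
  rw [intervalIntegrable_iff_integrableOn_Ioo_of_le zero_le_one] at hc
  have he : ∀ t ∈ Set.Ioo (0 : ℝ) 1, (t : ℂ) ^ ((u : ℂ) - 1) * (1 - (t : ℂ)) ^ ((v : ℂ) - 1)
      = ((t ^ (u - 1) * (1 - t) ^ (v - 1) : ℝ) : ℂ) := by
    intro t ht
    rw [Complex.ofReal_mul, Complex.ofReal_cpow ht.1.le, Complex.ofReal_cpow (sub_pos.2 ht.2).le]
    push_cast
    rfl
  have hc' := hc.congr_fun he measurableSet_Ioo
  constructor
  · have := hc'.re
    simp only [RCLike.re_to_complex, Complex.ofReal_re] at this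
    exact this
  · have h := ProbabilityTheory.beta_eq_betaIntegralReal u v hu hv
    rw [ProbabilityTheory.beta] at h
    rw [h, Complex.betaIntegral, intervalIntegral.integral_of_le zero_le_one,
      integral_Ioc_eq_integral_Ioo, setIntegral_congr_fun measurableSet_Ioo he,
      integral_complex_ofReal, Complex.ofReal_re]

theorem eulerF21_upper (σ a b x : ℝ) (hb : a + 1 < b) (ha : 1 < a + 1)
    (hσ0 : 0 < σ) (hσ1 : σ ≤ 1) (hx1 : -1 < x) (hx0 : x < 0) :
    eulerF21 σ a b x < (1 + a * x / (b - 1)) ^ (-σ) := by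
  have ha0 : 0 < a := by linarith
  have hb1 : 0 < b - 1 := by linarith
  obtain ⟨m, hm⟩ : ∃ m, m = a / (b - 1) := ⟨_, rfl⟩
  have hm0 : 0 < m := by rw [hm]; positivity
  have hm1 : m < 1 := by rw [hm, div_lt_one hb1]; linarith
  have hmx : a * x / (b - 1) = m * x := by rw [hm]; ring
  rw [hmx, eulerF21]
  obtain ⟨P, hP⟩ : ∃ P, P = (1 + m * x) ^ (-σ) := ⟨_, rfl⟩
  obtain ⟨K, hK⟩ : ∃ K, K = σ * (-x) * (1 - m) / (1 + m * x) := ⟨_, rfl⟩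
  obtain ⟨i1, e1⟩ := beta_int a (b - a) ha0 (by linarith)
  obtain ⟨i2, e2⟩ := beta_int (a + 1) (b - a - 1) (by linarith) (by linarith)
  rw [show a + (b - a) = b by ring] at e1
  rw [show a + 1 + (b - a - 1) = b by ring] at e2
  have hGa := Gamma_pos_of_pos ha0
  have hGb : 0 < Gamma b := Gamma_pos_of_pos (by linarith)
  have hGc : 0 < Gamma (b - a - 1) := Gamma_pos_of_pos (by linarith)
  have g1 := Gamma_add_one ha0.ne'
  have g2 : Gamma (b - a) = (b - a - 1) * Gamma (b - a - 1) := by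
    rw [← Gamma_add_one (by linarith : b - a - 1 ≠ 0)]; congr 1; ring
  have hc1 : 0 < b - a - 1 := by linarith
  set p : ℝ → ℝ := fun t => t ^ (a - 1) * (1 - t) ^ (b - a - 1) with hp
  set q : ℝ → ℝ := fun t => t ^ (a + 1 - 1) * (1 - t) ^ (b - a - 1 - 1) with hq
  set f : ℝ → ℝ := fun t => t ^ (a - 1) * (1 - t) ^ (b - a - 1) * (1 + x * t) ^ (-σ) with hf
  set g : ℝ → ℝ := fun t => P * (1 - K * m) * p t + P * K * (1 - m) * q t with hg
  have ig : IntegrableOn g (Set.Ioo 0 1) := (i1.const_mul _).add (i2.const_mul _)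
  have eg : ∫ t in Set.Ioo (0 : ℝ) 1, g t = P * (Gamma a * Gamma (b - a) / Gamma b) := by
    rw [hg, integral_add (i1.const_mul _) (i2.const_mul _), integral_const_mul,
      integral_const_mul, e1, e2, g1, g2, hm]
    field_simp
    ring
  have key : ∀ t ∈ Set.Ioo (0 : ℝ) 1, g t - f t = t ^ (a - 1) * (1 - t) ^ (b - a - 1 - 1) *
      (P * ((1 - t) + K * (t - m)) - (1 - t) * (1 + x * t) ^ (-σ)) := by
    intro t ht
    have h1 : t ^ (a + 1 - 1) = t ^ (a - 1) * t := by
      rw [← rpow_add_one ht.1.ne']; congr 1; ring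
    have h2 : (1 - t) ^ (b - a - 1) = (1 - t) ^ (b - a - 1 - 1) * (1 - t) := by
      rw [← rpow_add_one (sub_pos.2 ht.2).ne']; congr 1; ring
    simp only [hg, hf, hp, hq, h1, h2]
    ring
  have hw : ∀ t ∈ Set.Ioo (0 : ℝ) 1, 0 < t ^ (a - 1) * (1 - t) ^ (b - a - 1 - 1) :=
    fun t ht => mul_pos (rpow_pos_of_pos ht.1 _) (rpow_pos_of_pos (sub_pos.2 ht.2) _)
  have hnn : ∀ t ∈ Set.Ioo (0 : ℝ) 1, 0 ≤ g t - f t := by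
    intro t ht
    rw [key t ht, hP, hK]
    exact mul_nonneg (hw t ht).le (core_lt σ m x t hσ0 hσ1 hx1 hx0 hm0 hm1 ht.1 ht.2).1
  have hpos : ∀ t ∈ Set.Ioo (0 : ℝ) 1, t ≠ m → 0 < g t - f t := by
    intro t ht htm
    rw [key t ht, hP, hK]
    exact mul_pos (hw t ht) ((core_lt σ m x t hσ0 hσ1 hx1 hx0 hm0 hm1 ht.1 ht.2).2 htm)
  have hfnn : ∀ t ∈ Set.Ioo (0 : ℝ) 1, 0 ≤ f t := by
    intro t ht
    have hU : 0 < 1 + x * t := by nlinarith [ht.1, ht.2]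
    exact mul_nonneg (mul_nonneg (rpow_nonneg ht.1.le _) (rpow_nonneg (sub_pos.2 ht.2).le _))
      (rpow_nonneg hU.le _)
  have hfm : Measurable f := by rw [hf]; fun_prop
  have iF : IntegrableOn f (Set.Ioo 0 1) := by
    refine Integrable.mono' ig hfm.aestronglyMeasurable ?_
    filter_upwards [ae_restrict_mem measurableSet_Ioo] with t ht
    rw [norm_of_nonneg (hfnn t ht)]
    linarith [hnn t ht]
  have hlt : 0 < ∫ t in Set.Ioo (0 : ℝ) 1, (g t - f t) := by
    refine (setIntegral_pos_iff_support_of_nonneg_ae (f := fun t => g t - f t) ?_ (ig.sub iF)).2 ?_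
    swap
    · have hsub : Set.Ioo 0 m ⊆ Function.support (fun t => g t - f t) ∩ Set.Ioo (0 : ℝ) 1 := by
        intro t ht
        have h' : t ∈ Set.Ioo (0 : ℝ) 1 := ⟨ht.1, ht.2.trans hm1⟩
        exact ⟨(hpos t h' ht.2.ne).ne', h'⟩
      refine lt_of_lt_of_le ?_ (measure_mono hsub)
      simpa using hm0
    · filter_upwards [ae_restrict_mem measurableSet_Ioo] with t ht
      exact hnn t ht
  rw [integral_sub ig iF, eg] at hlt
  have hB : 0 < Gamma a * Gamma (b - a) := by
    rw [g2]; positivity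
  rw [← hP]
  have hlt' := sub_pos.1 hlt
  calc _ < Gamma b / (Gamma a * Gamma (b - a)) * (P * (Gamma a * Gamma (b - a) / Gamma b)) :=
        mul_lt_mul_of_pos_left hlt' (by positivity)
    _ = P := by
      have : 0 < Gamma (b - a) := by rw [g2]; positivity
      field_simp
end

section
/- Let a, b, c, d, e be real with d + e − b − c > 0, b > 0, c > 0, δ > 0 and min(b, c) < min(d, e). Then the function x ↦ G(a, b+δ, c+δ; d+δ, e+δ; −x) / G(a, b, c; d, e; −x) is monotone decreasing on (−1, ∞) if a > 0 and monotone increasing on (−1, ∞) if a < 0. -/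
open MeasureTheory Real

/-- Pochhammer symbol `(a)_n = a(a+1)⋯(a+n−1)`. -/
noncomputable def poch (a : ℝ) (n : ℕ) : ℝ := (ascPochhammer ℝ n).eval a

/-- Gauss hypergeometric series `₂F₁(α, β; γ; y)`. -/
noncomputable def F21 (α β γ y : ℝ) : ℝ :=
  ∑' n : ℕ, poch α n * poch β n / (poch γ n * (n.factorial : ℝ)) * y ^ n

/-- `G(a, b, c; d, e; −x) = ₃F₂(a, b, c; d, e; −x)` defined via the integral
representation of Lemma 2. -/
noncomputable def G32 (a b c d e x : ℝ) : ℝ :=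
  Gamma d * Gamma e / (Gamma b * Gamma c * Gamma (d + e - b - c)) *
    ∫ t in Set.Ioo (0 : ℝ) 1,
      t ^ (b - 1) * (1 - t) ^ (d + e - b - c - 1) * (1 + x * t) ^ (-a) *
        F21 (e - c) (d - c) (d + e - b - c) (1 - t)

/-- hypergeometric coefficient -/
noncomputable def hcoef (α β γ : ℝ) (n : ℕ) : ℝ :=
  poch α n * poch β n / (poch γ n * (n.factorial : ℝ))

lemma poch_zero' (a : ℝ) : poch a 0 = 1 := by simp [poch]

lemma poch_succ' (a : ℝ) (n : ℕ) : poch a (n + 1) = poch a n * (a + n) := by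
  simp [poch, ascPochhammer_succ_eval]

lemma poch_pos' {a : ℝ} (ha : 0 < a) (n : ℕ) : 0 < poch a n := ascPochhammer_pos n a ha

lemma hcoef_zero (α β γ : ℝ) : hcoef α β γ 0 = 1 := by simp [hcoef, poch_zero']

lemma hcoef_succ (α β : ℝ) {γ : ℝ} (hγ : 0 < γ) (n : ℕ) :
    hcoef α β γ (n + 1) = hcoef α β γ n * ((α + n) * (β + n) / ((γ + n) * (n + 1))) := by
  have h1 := (poch_pos' hγ n).ne'
  have h2 : (γ + n) ≠ 0 := by positivity
  have h3 : (n.factorial : ℝ) ≠ 0 := by positivity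
  have h4 : (n + 1 : ℝ) ≠ 0 := by positivity
  simp only [hcoef, poch_succ', Nat.factorial_succ]
  push_cast
  field_simp

lemma hcoef_rec (α β : ℝ) {γ : ℝ} (hγ : 0 < γ) (n : ℕ) :
    (n + 1) * (γ + n) * hcoef α β γ (n + 1) = (α + n) * (β + n) * hcoef α β γ n := by
  have h2 : (γ + n) ≠ 0 := by positivity
  have h4 : (n + 1 : ℝ) ≠ 0 := by positivity
  rw [hcoef_succ α β hγ]
  field_simp

lemma hcoef_pos {α β γ : ℝ} (hα : 0 < α) (hβ : 0 < β) (hγ : 0 < γ) (n : ℕ) :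
    0 < hcoef α β γ n := by
  have := poch_pos' hα n
  have := poch_pos' hβ n
  have := poch_pos' hγ n
  unfold hcoef
  positivity

open PowerSeries in
lemma ode_coeff (α β γ : ℝ) (f : PowerSeries ℝ) (n : ℕ) :
    coeff n (X * (1 - X) * d⁄dX ℝ (d⁄dX ℝ f) +
      (C γ - C (α + β + 1) * X) * d⁄dX ℝ f - C (α * β) * f) =
    (n + 1) * (γ + n) * coeff (n + 1) f - (α + n) * (β + n) * coeff n f := by
  have e : (X * (1 - X) * d⁄dX ℝ (d⁄dX ℝ f) +
      (C γ - C (α + β + 1) * X) * d⁄dX ℝ f - C (α * β) * f) =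
      X * d⁄dX ℝ (d⁄dX ℝ f) - X * (X * d⁄dX ℝ (d⁄dX ℝ f)) + C γ * d⁄dX ℝ f
        - C (α + β + 1) * (X * d⁄dX ℝ f) - C (α * β) * f := by ring
  rw [e]
  obtain ⟨k, hk⟩ : ∃ k, k = α + β + 1 := ⟨_, rfl⟩
  rw [← hk]
  rcases n with _ | _ | n
  · simp only [map_add, map_sub, coeff_C_mul, coeff_zero_X_mul, coeff_derivative]
    push_cast
    try rw [hk]
    ring
  · simp only [map_add, map_sub, coeff_C_mul, coeff_succ_X_mul, coeff_zero_X_mul, coeff_derivative]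
    push_cast
    try rw [hk]
    ring
  · simp only [map_add, map_sub, coeff_C_mul, coeff_succ_X_mul, coeff_derivative]
    push_cast
    try rw [hk]
    ring

open PowerSeries in
lemma euler_formal (α β : ℝ) {γ : ℝ} (hγ : 0 < γ) :
    (mk (hcoef (α + β - γ) 1 1)) * (mk (hcoef (γ - α) (γ - β) γ)) = mk (hcoef α β γ) := by
  set p := α + β - γ with hp
  set u : PowerSeries ℝ := mk (hcoef p 1 1) with hu
  set H : PowerSeries ℝ := mk (hcoef (γ - α) (γ - β) γ) with hH
  have hu1 : (1 - X) * d⁄dX ℝ u = C p * u := by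
    have e : (1 - X) * d⁄dX ℝ u = d⁄dX ℝ u - X * d⁄dX ℝ u := by ring
    rw [e]
    ext n
    have key := hcoef_rec p 1 one_pos n
    have h4 : (n + 1 : ℝ) ≠ 0 := by positivity
    have key2 : (n + 1) * hcoef p 1 1 (n + 1) = (p + n) * hcoef p 1 1 n := by
      apply mul_left_cancel₀ h4
      linear_combination key
    rcases n with _ | n
    · simp only [map_sub, coeff_C_mul, coeff_zero_X_mul, coeff_derivative, hu, coeff_mk]
      push_cast at key2 ⊢
      linear_combination key2
    · simp only [map_sub, coeff_C_mul, coeff_succ_X_mul, coeff_derivative, hu, coeff_mk]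
      push_cast at key2 ⊢
      linear_combination key2
  have hu2 : (1 - X) * d⁄dX ℝ (d⁄dX ℝ u) = (C p + 1) * d⁄dX ℝ u := by
    have := congrArg (d⁄dX ℝ) hu1
    simp only [Derivation.leibniz, map_sub, derivative_X, derivative_one, smul_eq_mul,
      derivative_C] at this
    linear_combination this
  have hH1 : X * (1 - X) * d⁄dX ℝ (d⁄dX ℝ H) +
      (C γ - C ((γ - α) + (γ - β) + 1) * X) * d⁄dX ℝ H - C ((γ - α) * (γ - β)) * H = 0 := by
    ext n
    rw [ode_coeff, hH, coeff_mk, coeff_mk, hcoef_rec _ _ hγ]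
    simp
  have hL : X * (1 - X) * d⁄dX ℝ (d⁄dX ℝ (u * H)) +
      (C γ - C (α + β + 1) * X) * d⁄dX ℝ (u * H) - C (α * β) * (u * H) = 0 := by
    have hne : (1 - X : PowerSeries ℝ) ≠ 0 := by
      intro h
      have := congrArg (coeff 0) h
      simp at this
    apply mul_left_cancel₀ hne
    rw [mul_zero]
    simp only [Derivation.leibniz, map_add, smul_eq_mul]
    have hpC : (C p : PowerSeries ℝ) = C α + C β - C γ := by simp [hp]
    simp only [map_add, map_sub, map_mul, map_one, hpC] at hH1 hu1 hu2 ⊢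
    linear_combination (X * (1 - X) * H) * hu2
      + (X * H * (C α + C β - C γ + 1) + 2 * X * (1 - X) * d⁄dX ℝ H +
          (C γ - (C α + C β + 1) * X) * H) * hu1 + (1 - X) * u * hH1
  have hrec : ∀ n : ℕ, (n + 1) * (γ + n) * coeff (n + 1) (u * H)
      = (α + n) * (β + n) * coeff n (u * H) := by
    intro n
    have := ode_coeff α β γ (u * H) n
    rw [hL] at this
    simp only [map_zero] at this
    linarith
  ext n
  rw [coeff_mk]
  induction n with
  | zero => simp [hu, hH, hcoef_zero]
  | succ n ih =>
    have h2 : (γ + n) ≠ 0 := by positivity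
    have h4 : (n + 1 : ℝ) ≠ 0 := by positivity
    apply mul_left_cancel₀ (mul_ne_zero h4 h2)
    rw [hrec, ih, hcoef_rec _ _ hγ]

open Filter Topology in
lemma hcoef_summable (α β : ℝ) {γ y : ℝ} (hγ : 0 < γ) (hy0 : 0 ≤ y) (hy : y < 1) :
    Summable (fun n => ‖hcoef α β γ n * y ^ n‖) := by
  obtain ⟨r, hr1, hr2⟩ := exists_between hy
  have hq : ∀ c : ℝ, ∀ g : ℝ, Tendsto (fun n : ℕ => (c + n) / (g + n)) atTop (𝓝 1) := by
    intro c g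
    have h := tendsto_add_mul_div_add_mul_atTop_nhds c g (1 : ℝ) (one_ne_zero (α := ℝ))
    simpa using h
  have hlim : Tendsto (fun n : ℕ => |((α + n) / (γ + n)) * ((β + n) / (1 + n)) * y|) atTop (𝓝 y) := by
    have := (((hq α γ).mul (hq β 1)).mul_const y).abs
    simpa [abs_of_nonneg hy0] using this
  apply summable_of_ratio_norm_eventually_le hr2
  filter_upwards [hlim.eventually_le_const hr1] with n hn
  simp only [norm_norm]
  rw [hcoef_succ α β hγ, pow_succ]
  have e : hcoef α β γ n * ((α + n) * (β + n) / ((γ + n) * (n + 1))) * (y ^ n * y)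
    = (((α + n) / (γ + n)) * ((β + n) / (1 + n)) * y) * (hcoef α β γ n * y ^ n) := by
    have h2 : (γ + n) ≠ 0 := by positivity
    have h4 : (n + 1 : ℝ) ≠ 0 := by positivity
    have h5 : (1 + n : ℝ) ≠ 0 := by positivity
    field_simp
    ring
  rw [e, norm_mul]
  exact mul_le_mul_of_nonneg_right hn (norm_nonneg _)

lemma F21_eq (α β γ y : ℝ) : F21 α β γ y = ∑' n, hcoef α β γ n * y ^ n := rfl

lemma F21_pos {α β γ y : ℝ} (hα : 0 < α) (hβ : 0 < β) (hγ : 0 < γ) (hy0 : 0 ≤ y) (hy : y < 1) :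
    0 < F21 α β γ y := by
  rw [F21_eq]
  refine (hcoef_summable α β hγ hy0 hy).of_norm.tsum_pos
    (fun n => mul_nonneg (hcoef_pos hα hβ hγ n).le (pow_nonneg hy0 n)) 0 ?_
  simp [hcoef_zero]

lemma F21_euler (α β : ℝ) {γ y : ℝ} (hγ : 0 < γ) (hy0 : 0 ≤ y) (hy : y < 1) :
    F21 (α + β - γ) 1 1 y * F21 (γ - α) (γ - β) γ y = F21 α β γ y := by
  simp only [F21_eq]
  rw [tsum_mul_tsum_eq_tsum_sum_antidiagonal_of_summable_norm
    (hcoef_summable _ _ one_pos hy0 hy) (hcoef_summable _ _ hγ hy0 hy)]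
  congr 1
  ext n
  have := congrArg (PowerSeries.coeff n) (euler_formal α β hγ)
  rw [PowerSeries.coeff_mul, PowerSeries.coeff_mk] at this
  rw [← this, Finset.sum_mul]
  refine Finset.sum_congr rfl fun kl hkl => ?_
  rw [← Finset.HasAntidiagonal.mem_antidiagonal.1 hkl, pow_add, PowerSeries.coeff_mk, PowerSeries.coeff_mk]
  ring

lemma F21_pos' {b c d e y : ℝ} (hde : 0 < d + e - b - c)
    (hmin : min b c < min d e) (hy0 : 0 ≤ y) (hy : y < 1) :
    0 < F21 (e - c) (d - c) (d + e - b - c) y := by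
  rw [lt_min_iff] at hmin
  by_cases hbc : c ≤ b
  · rw [min_eq_right hbc] at hmin
    exact F21_pos (by linarith) (by linarith) hde hy0 hy
  · push Not at hbc
    rw [min_eq_left hbc.le] at hmin
    have h := F21_euler (d - b) (e - b) hde hy0 hy
    rw [show d - b + (e - b) - (d + e - b - c) = c - b by ring,
      show d + e - b - c - (d - b) = e - c by ring,
      show d + e - b - c - (e - b) = d - c by ring] at h
    have h1 : 0 < F21 (d - b) (e - b) (d + e - b - c) y :=
      F21_pos (by linarith) (by linarith) hde hy0 hy
    have h2 : 0 < F21 (c - b) 1 1 y := F21_pos (by linarith) one_pos one_pos hy0 hy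
    rw [← h] at h1
    exact pos_of_mul_pos_right h1 h2.le

lemma base_pos {x t : ℝ} (hx : -1 < x) (h0 : 0 ≤ t) (h1 : t ≤ 1) : 0 < 1 + x * t := by
  rcases h0.eq_or_lt with h | h
  · simp [← h]
  · nlinarith [mul_pos (show 0 < 1 + x by linarith) h]

/-- abstract Chebyshev step -/
lemma ratio_aux (a δ : ℝ) (hδ : 0 < δ) (w : ℝ → ℝ) (hw : ∀ t ∈ Set.Ioo (0:ℝ) 1, 0 ≤ w t) :
    (0 < a →
      AntitoneOn (fun x => (∫ t in Set.Ioo (0:ℝ) 1, t ^ δ * (w t * (1 + x * t) ^ (-a))) /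
        (∫ t in Set.Ioo (0:ℝ) 1, w t * (1 + x * t) ^ (-a))) (Set.Ioi (-1 : ℝ))) ∧
    (a < 0 →
      MonotoneOn (fun x => (∫ t in Set.Ioo (0:ℝ) 1, t ^ δ * (w t * (1 + x * t) ^ (-a))) /
        (∫ t in Set.Ioo (0:ℝ) 1, w t * (1 + x * t) ^ (-a))) (Set.Ioi (-1 : ℝ))) := by
  have hcont : ∀ s x : ℝ, -1 < x → ContinuousOn (fun t : ℝ => (1 + x * t) ^ s) (Set.Icc 0 1) := by
    intro s x hx
    apply ContinuousOn.rpow_const (by fun_prop)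
    intro t ht
    exact Or.inl (base_pos hx ht.1 ht.2).ne'
  have hmulc : ∀ f g : ℝ → ℝ, IntegrableOn f (Set.Ioo 0 1) → ContinuousOn g (Set.Icc 0 1) →
      IntegrableOn (fun t => f t * g t) (Set.Ioo 0 1) := by
    intro f g hf hg
    rw [← integrableOn_Icc_iff_integrableOn_Ioo] at hf ⊢
    exact hf.mul_continuousOn hg isCompact_Icc
  have hnn : ∀ x, -1 < x → ∀ t ∈ Set.Ioo (0:ℝ) 1, 0 ≤ w t * (1 + x * t) ^ (-a) := fun x hx t ht =>
    mul_nonneg (hw t ht) (rpow_nonneg (base_pos hx ht.1.le ht.2.le).le _)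
  by_cases hint : IntegrableOn w (Set.Ioo 0 1)
  swap
  · have hz : ∀ x ∈ Set.Ioi (-1:ℝ), (∫ t in Set.Ioo (0:ℝ) 1, w t * (1 + x * t) ^ (-a)) = 0 := by
      intro x hx
      apply integral_undef
      intro h
      apply hint
      have := hmulc _ _ h (hcont a x hx)
      refine this.congr_fun ?_ measurableSet_Ioo
      intro t ht
      have hp := base_pos hx ht.1.le ht.2.le
      simp only []
      rw [mul_assoc, ← rpow_add hp]
      simp
    constructor
    · intro _ x hx y hy _
      simp [hz x hx, hz y hy]
    · intro _ x hx y hy _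
      simp [hz x hx, hz y hy]
  have hD : ∀ x, -1 < x → IntegrableOn (fun t => w t * (1 + x * t) ^ (-a)) (Set.Ioo 0 1) :=
    fun x hx => hmulc _ _ hint (hcont _ x hx)
  have hpowc : ContinuousOn (fun t : ℝ => t ^ δ) (Set.Icc 0 1) :=
    (continuous_id.rpow_const (fun _ => Or.inr hδ.le)).continuousOn
  have hN : ∀ x, -1 < x → IntegrableOn (fun t => t ^ δ * (w t * (1 + x * t) ^ (-a))) (Set.Ioo 0 1) := by
    intro x hx
    refine (hmulc _ _ (hD x hx) hpowc).congr_fun ?_ measurableSet_Ioo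
    intro t _
    simp only []
    ring
  by_cases hw0 : w =ᵐ[volume.restrict (Set.Ioo (0:ℝ) 1)] 0
  · have hz : ∀ x, (∫ t in Set.Ioo (0:ℝ) 1, w t * (1 + x * t) ^ (-a)) = 0 := by
      intro x
      apply integral_eq_zero_of_ae
      filter_upwards [hw0] with t ht
      simp [ht]
    constructor
    · intro _ x hx y hy _
      simp [hz]
    · intro _ x hx y hy _
      simp [hz]
  have hDpos : ∀ x, -1 < x → 0 < ∫ t in Set.Ioo (0:ℝ) 1, w t * (1 + x * t) ^ (-a) := by
    intro x hx
    have hge := setIntegral_nonneg (μ := volume) measurableSet_Ioo (hnn x hx)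
    refine lt_of_le_of_ne hge fun h => hw0 ?_
    have hae : 0 ≤ᵐ[volume.restrict (Set.Ioo (0:ℝ) 1)] (fun t => w t * (1 + x * t) ^ (-a)) :=
      (ae_restrict_iff' measurableSet_Ioo).2 (Filter.Eventually.of_forall (hnn x hx))
    have := (integral_eq_zero_iff_of_nonneg_ae hae (hD x hx)).1 h.symm
    filter_upwards [this, ae_restrict_mem measurableSet_Ioo] with t ht htm
    have hp := rpow_pos_of_pos (base_pos hx htm.1.le htm.2.le) (-a)
    simpa [hp.ne'] using ht
  -- mean point
  have hmean : ∀ x, -1 < x → ∃ t0 : ℝ, 0 ≤ t0 ∧ t0 ≤ 1 ∧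
      t0 ^ δ = (∫ t in Set.Ioo (0:ℝ) 1, t ^ δ * (w t * (1 + x * t) ^ (-a))) /
        (∫ t in Set.Ioo (0:ℝ) 1, w t * (1 + x * t) ^ (-a)) := by
    intro x hx
    set N := ∫ t in Set.Ioo (0:ℝ) 1, t ^ δ * (w t * (1 + x * t) ^ (-a)) with hNd
    have hN0 : 0 ≤ N := setIntegral_nonneg measurableSet_Ioo fun t ht =>
      mul_nonneg (rpow_nonneg ht.1.le _) (hnn x hx t ht)
    have hN1 : N ≤ ∫ t in Set.Ioo (0:ℝ) 1, w t * (1 + x * t) ^ (-a) := by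
      refine setIntegral_mono_on (hN x hx) (hD x hx) measurableSet_Ioo fun t ht => ?_
      exact mul_le_of_le_one_left (hnn x hx t ht) (rpow_le_one ht.1.le ht.2.le hδ.le)
    have hm0 := div_nonneg hN0 (hDpos x hx).le
    have hm1 := (div_le_one (hDpos x hx)).2 hN1
    refine ⟨_ ^ δ⁻¹, rpow_nonneg hm0 _, rpow_le_one hm0 hm1 (by positivity), ?_⟩
    exact rpow_inv_rpow hm0 hδ.ne'
  -- key: quotient of kernels
  have hq : ∀ x y, -1 < x → x ≤ y → ∀ s t : ℝ, 0 ≤ s → s ≤ t → t ≤ 1 →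
      (1 + y * s) / (1 + x * s) ≤ (1 + y * t) / (1 + x * t) := by
    intro x y hx hxy s t hs hst ht
    rw [div_le_div_iff₀ (base_pos hx hs (hst.trans ht)) (base_pos hx (hs.trans hst) ht)]
    nlinarith [mul_nonneg (sub_nonneg.2 hxy) (sub_nonneg.2 hst)]
  have hk : ∀ x y, -1 < x → x ≤ y → ∀ t : ℝ, 0 ≤ t → t ≤ 1 →
      (1 + y * t) ^ (-a) = ((1 + y * t) / (1 + x * t)) ^ (-a) * (1 + x * t) ^ (-a) := by
    intro x y hx hxy t h0 h1
    have p1 := base_pos hx h0 h1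
    have p2 := base_pos (hx.trans_le hxy) h0 h1
    rw [← mul_rpow (div_pos p2 p1).le p1.le, div_mul_cancel₀ _ p1.ne']
  -- final integration
  have hfin : ∀ x y, -1 < x → x ≤ y → ∀ t0 : ℝ,
      t0 ^ δ = (∫ t in Set.Ioo (0:ℝ) 1, t ^ δ * (w t * (1 + x * t) ^ (-a))) /
        (∫ t in Set.Ioo (0:ℝ) 1, w t * (1 + x * t) ^ (-a)) → ∀ R : ℝ,
      (∫ t in Set.Ioo (0:ℝ) 1, (t ^ δ - t0 ^ δ) * (((1 + y * t) / (1 + x * t)) ^ (-a) - R) *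
        (w t * (1 + x * t) ^ (-a))) =
      (∫ t in Set.Ioo (0:ℝ) 1, t ^ δ * (w t * (1 + y * t) ^ (-a))) -
        t0 ^ δ * (∫ t in Set.Ioo (0:ℝ) 1, w t * (1 + y * t) ^ (-a)) := by
    intro x y hx hxy t0 ht0 R
    have hy := hx.trans_le hxy
    have e : (∫ t in Set.Ioo (0:ℝ) 1, (t ^ δ - t0 ^ δ) * (((1 + y * t) / (1 + x * t)) ^ (-a) - R) *
        (w t * (1 + x * t) ^ (-a))) = ∫ t in Set.Ioo (0:ℝ) 1,
        ((t ^ δ * (w t * (1 + y * t) ^ (-a)) - t0 ^ δ * (w t * (1 + y * t) ^ (-a))) -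
        (R * (t ^ δ * (w t * (1 + x * t) ^ (-a))) - R * t0 ^ δ * (w t * (1 + x * t) ^ (-a)))) := by
      refine setIntegral_congr_fun measurableSet_Ioo fun t ht => ?_
      rw [hk x y hx hxy t ht.1.le ht.2.le]
      ring
    have i1 : IntegrableOn (fun t => t ^ δ * (w t * (1 + y * t) ^ (-a)) -
        t0 ^ δ * (w t * (1 + y * t) ^ (-a))) (Set.Ioo 0 1) := (hN y hy).sub ((hD y hy).const_mul _)
    have i2 : IntegrableOn (fun t => R * (t ^ δ * (w t * (1 + x * t) ^ (-a))) -
        R * t0 ^ δ * (w t * (1 + x * t) ^ (-a))) (Set.Ioo 0 1) :=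
      ((hN x hx).const_mul _).sub ((hD x hx).const_mul _)
    rw [e, integral_sub i1 i2,
      integral_sub (hN y hy) ((hD y hy).const_mul _),
      integral_sub ((hN x hx).const_mul _) ((hD x hx).const_mul _),
      integral_const_mul, integral_const_mul, integral_const_mul]
    rw [eq_div_iff (hDpos x hx).ne'] at ht0
    rw [mul_assoc, ht0]
    ring
  constructor
  · intro ha x hx y hy hxy
    obtain ⟨t0, h0, h1, ht0⟩ := hmean x hx
    have hf := hfin x y hx hxy t0 ht0 (((1 + y * t0) / (1 + x * t0)) ^ (-a))
    have hle : (∫ t in Set.Ioo (0:ℝ) 1, (t ^ δ - t0 ^ δ) * (((1 + y * t) / (1 + x * t)) ^ (-a) -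
        ((1 + y * t0) / (1 + x * t0)) ^ (-a)) * (w t * (1 + x * t) ^ (-a))) ≤ 0 := by
      refine setIntegral_nonpos measurableSet_Ioo fun t ht => ?_
      refine mul_nonpos_of_nonpos_of_nonneg ?_ (hnn x hx t ht)
      rcases le_total t t0 with h | h
      · refine mul_nonpos_of_nonpos_of_nonneg (sub_nonpos.2 (rpow_le_rpow ht.1.le h hδ.le))
          (sub_nonneg.2 (rpow_le_rpow_of_nonpos ?_ (hq x y hx hxy t t0 ht.1.le h h1) (by linarith)))
        exact div_pos (base_pos hy ht.1.le ht.2.le) (base_pos hx ht.1.le ht.2.le)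
      · refine mul_nonpos_of_nonneg_of_nonpos (sub_nonneg.2 (rpow_le_rpow h0 h hδ.le))
          (sub_nonpos.2 (rpow_le_rpow_of_nonpos ?_ (hq x y hx hxy t0 t h0 h ht.2.le) (by linarith)))
        exact div_pos (base_pos hy h0 h1) (base_pos hx h0 h1)
    simp only []
    rw [← ht0, div_le_iff₀ (hDpos y hy)]
    linarith
  · intro ha x hx y hy hxy
    obtain ⟨t0, h0, h1, ht0⟩ := hmean x hx
    have hf := hfin x y hx hxy t0 ht0 (((1 + y * t0) / (1 + x * t0)) ^ (-a))
    have hle : 0 ≤ (∫ t in Set.Ioo (0:ℝ) 1, (t ^ δ - t0 ^ δ) * (((1 + y * t) / (1 + x * t)) ^ (-a) -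
        ((1 + y * t0) / (1 + x * t0)) ^ (-a)) * (w t * (1 + x * t) ^ (-a))) := by
      refine setIntegral_nonneg measurableSet_Ioo fun t ht => ?_
      refine mul_nonneg ?_ (hnn x hx t ht)
      rcases le_total t t0 with h | h
      · refine mul_nonneg_of_nonpos_of_nonpos (sub_nonpos.2 (rpow_le_rpow ht.1.le h hδ.le))
          (sub_nonpos.2 (rpow_le_rpow ?_ (hq x y hx hxy t t0 ht.1.le h h1) (by linarith)))
        exact (div_pos (base_pos hy ht.1.le ht.2.le) (base_pos hx ht.1.le ht.2.le)).le
      · refine mul_nonneg (sub_nonneg.2 (rpow_le_rpow h0 h hδ.le))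
          (sub_nonneg.2 (rpow_le_rpow ?_ (hq x y hx hxy t0 t h0 h ht.2.le) (by linarith)))
        exact (div_pos (base_pos hy h0 h1) (base_pos hx h0 h1)).le
    simp only []
    rw [← ht0, le_div_iff₀ (hDpos y hy)]
    linarith

/-- Theorem 6: the ratio `G(a, b+δ, c+δ; d+δ, e+δ; −x)/G(a, b, c; d, e; −x)` is monotone
decreasing on `(−1, ∞)` if `a > 0` and monotone increasing if `a < 0`. -/
theorem G32_ratio_monotone (a b c d e δ : ℝ) (hde : 0 < d + e - b - c)
    (hb : 0 < b) (hc : 0 < c) (hδ : 0 < δ) (hmin : min b c < min d e) :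
    (0 < a →
      AntitoneOn (fun x => G32 a (b + δ) (c + δ) (d + δ) (e + δ) x / G32 a b c d e x)
        (Set.Ioi (-1 : ℝ))) ∧
    (a < 0 →
      MonotoneOn (fun x => G32 a (b + δ) (c + δ) (d + δ) (e + δ) x / G32 a b c d e x)
        (Set.Ioi (-1 : ℝ))) := by
  set w : ℝ → ℝ := fun t => t ^ (b - 1) * (1 - t) ^ (d + e - b - c - 1) *
        F21 (e - c) (d - c) (d + e - b - c) (1 - t) with hwd
  have hw : ∀ t ∈ Set.Ioo (0:ℝ) 1, 0 ≤ w t := by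
    intro t ht
    have h1 : 0 < 1 - t := by linarith [ht.2]
    exact mul_nonneg (mul_nonneg (rpow_nonneg ht.1.le _) (rpow_nonneg h1.le _))
      (F21_pos' hde hmin h1.le (by linarith [ht.1])).le
  have hm0 : 0 < min b c := lt_min hb hc
  have hdp : 0 < d := hm0.trans (hmin.trans_le (min_le_left _ _))
  have hep : 0 < e := hm0.trans (hmin.trans_le (min_le_right _ _))
  obtain ⟨K, hK, hGK⟩ : ∃ K : ℝ, 0 ≤ K ∧ ∀ x,
      G32 a (b + δ) (c + δ) (d + δ) (e + δ) x / G32 a b c d e x =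
      K * ((∫ t in Set.Ioo (0:ℝ) 1, t ^ δ * (w t * (1 + x * t) ^ (-a))) /
        (∫ t in Set.Ioo (0:ℝ) 1, w t * (1 + x * t) ^ (-a))) := by
    refine ⟨(Gamma (d + δ) * Gamma (e + δ) / (Gamma (b + δ) * Gamma (c + δ) *
      Gamma (d + e - b - c))) / (Gamma d * Gamma e / (Gamma b * Gamma c *
      Gamma (d + e - b - c))), ?_, fun x => ?_⟩
    · have := Gamma_pos_of_pos hdp
      have := Gamma_pos_of_pos hep
      have := Gamma_pos_of_pos hb
      have := Gamma_pos_of_pos hc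
      have := Gamma_pos_of_pos hde
      have := Gamma_pos_of_pos (add_pos hdp hδ)
      have := Gamma_pos_of_pos (add_pos hep hδ)
      have := Gamma_pos_of_pos (add_pos hb hδ)
      have := Gamma_pos_of_pos (add_pos hc hδ)
      positivity
    · unfold G32
      rw [mul_div_mul_comm]
      rw [show d + δ + (e + δ) - (b + δ) - (c + δ) = d + e - b - c by ring,
        show e + δ - (c + δ) = e - c by ring, show d + δ - (c + δ) = d - c by ring]
      congr 2
      · refine setIntegral_congr_fun measurableSet_Ioo fun t ht => ?_
        simp only [hwd]
        rw [show b + δ - 1 = δ + (b - 1) by ring, rpow_add ht.1]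
        ring
      · refine setIntegral_congr_fun measurableSet_Ioo fun t ht => ?_
        simp only [hwd]
        ring
  obtain ⟨h1, h2⟩ := ratio_aux a δ hδ w hw
  simp only [hGK]
  exact ⟨fun ha x hx y hy hxy => mul_le_mul_of_nonneg_left (h1 ha hx hy hxy) hK,
    fun ha x hx y hy hxy => mul_le_mul_of_nonneg_left (h2 ha hx hy hxy) hK⟩
end
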